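/- Global existence and uniqueness for the semidiscrete scheme with linear artificial viscosity: for every integer N ≥ 3, every ν ≥ 0 and every initial nodal datum u⁰ : ℤ/Nℤ → ℝ, there exists a unique differentiable function u : [0,∞) → (ℤ/Nℤ → ℝ) with u(0) = u⁰ that solves the mass-lumped Galerkin scheme with linear artificial viscosity for all t ≥ 0. -/

import Mathlib

open Set

/-- `u : ℝ → ZMod N → ℝ` solves the mass-lumped Galerkin scheme with linear
artificial viscosity, with initial nodal datum `u⁰`, on the time interval
`[0,∞)`: `u 0 = u⁰`, the nodal values are differentiable in time, and for all
`i` and all `t ≥ 0`,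
`h uᵢ'(t) = −(1/6)(uᵢ₊₁² + uᵢuᵢ₊₁ − uᵢuᵢ₋₁ − uᵢ₋₁²) + ν̂ (dᵢ − dᵢ₋₁)`,
where `h = 1/N`, `dᵢ = (uᵢ₊₁ − uᵢ)/h`, `ν̂ = max(U₀h/2, ν)` and
`U₀ = maxⱼ |u⁰ⱼ|`. -/
def SolvesLinearViscosityScheme (N : ℕ) [NeZero N] (ν : ℝ)
    (u0 : ZMod N → ℝ) (u : ℝ → ZMod N → ℝ) : Prop :=
  (∀ i, u 0 i = u0 i) ∧
  ∀ i, ∀ t ∈ Ici (0 : ℝ),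
    HasDerivWithinAt (fun s => u s i)
      ((-(1 / 6) * (u t (i + 1) ^ 2 + u t i * u t (i + 1)
            - u t i * u t (i - 1) - u t (i - 1) ^ 2)
          + max ((Finset.univ.sup' ⟨(0 : ZMod N), Finset.mem_univ _⟩
                fun j => |u0 j|) * (1 / (N : ℝ)) / 2) ν
            * ((u t (i + 1) - u t i) / (1 / (N : ℝ)))
          - max ((Finset.univ.sup' ⟨(0 : ZMod N), Finset.mem_univ _⟩
                fun j => |u0 j|) * (1 / (N : ℝ)) / 2) ν
            * ((u t i - u t (i - 1)) / (1 / (N : ℝ)))) / (1 / (N : ℝ)))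
      (Ici (0 : ℝ)) t

lemma global_ode {E : Type*} [NormedAddCommGroup E] [NormedSpace ℝ E] [CompleteSpace E]
    (G : E → E) (K L : NNReal) (hK : LipschitzWith K G) (hL : ∀ x, ‖G x‖ ≤ L) (x0 : E) :
    ∃ u : ℝ → E, u 0 = x0 ∧ ∀ t ∈ Ici (0 : ℝ), HasDerivWithinAt u (G (u t)) (Ici 0) t := by
  have hloc : ∀ T : ℝ, 0 ≤ T → ∃ α : ℝ → E, α 0 = x0 ∧
      ∀ t ∈ Icc (0 : ℝ) T, HasDerivWithinAt α (G (α t)) (Icc 0 T) t := by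
    intro T hT
    have h : IsPicardLindelof (fun _ => G) (⟨0, by simp [hT]⟩ : Icc (0 : ℝ) T) x0
        (L * ⟨T, hT⟩) 0 L K := by
      apply IsPicardLindelof.of_time_independent (fun x _ => hL x) hK.lipschitzOnWith
      have : max T 0 = T := max_eq_left hT
      simp only [sub_zero, sub_self, this, NNReal.coe_zero, NNReal.coe_mul]
      exact le_rfl
    exact h.exists_eq_forall_mem_Icc_hasDerivWithinAt₀
  choose! α hα0 hα using hloc
  have hright : ∀ T S, 0 ≤ T → T ≤ S → ∀ t ∈ Ico (0 : ℝ) T,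
      HasDerivWithinAt (α S) (G (α S t)) (Ici t) t := by
    intro T S hT hTS t ht
    have h1 := hα S (hT.trans hTS) t ⟨ht.1, ht.2.le.trans hTS⟩
    have h2 : HasDerivWithinAt (α S) (G (α S t)) (Icc t S) t :=
      h1.mono (Icc_subset_Icc_left ht.1)
    exact h2.mono_of_mem_nhdsWithin (Icc_mem_nhdsGE (ht.2.trans_le hTS))
  have hcont : ∀ T S, 0 ≤ T → T ≤ S → ContinuousOn (α S) (Icc 0 T) := by
    intro T S hT hTS t ht
    exact ((hα S (hT.trans hTS) t ⟨ht.1, ht.2.trans hTS⟩).continuousWithinAt).mono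
      (Icc_subset_Icc_right hTS)
  have huniq : ∀ T S, 0 ≤ T → T ≤ S → EqOn (α T) (α S) (Icc 0 T) := by
    intro T S hT hTS
    exact ODE_solution_unique (v := fun _ => G) (fun _ => hK) (hcont T T hT le_rfl)
      (hright T T hT le_rfl) (hcont T S hT hTS) (hright T S hT hTS)
      (by rw [hα0 T hT, hα0 S (hT.trans hTS)])
  refine ⟨fun t => α t t, by simp [hα0], fun t ht => ?_⟩
  have ht : (0 : ℝ) ≤ t := ht
  have h1 := hα (t + 1) (by linarith) t ⟨ht, by linarith⟩
  have heq : ∀ s ∈ Icc (0 : ℝ) (t + 1), α s s = α (t + 1) s := fun s hs =>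
    huniq s (t + 1) hs.1 hs.2 ⟨hs.1, le_rfl⟩
  have h2 : HasDerivWithinAt (fun s => α s s) (G (α t t)) (Icc 0 (t + 1)) t := by
    rw [heq t ⟨ht, by linarith⟩]
    exact h1.congr heq (heq t ⟨ht, by linarith⟩)
  apply h2.mono_of_mem_nhdsWithin
  have : Ici (0 : ℝ) ∩ Iio (t + 1) ∈ nhdsWithin t (Ici 0) :=
    inter_mem_nhdsWithin _ (Iio_mem_nhds (by linarith))
  exact Filter.mem_of_superset this fun s hs => ⟨hs.1, (mem_Iio.1 hs.2).le⟩

/-- The right-hand side of the scheme. -/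
noncomputable def schemeField (N : ℕ) (c : ℝ) (x : ZMod N → ℝ) : ZMod N → ℝ := fun i =>
  (-(1 / 6) * (x (i + 1) ^ 2 + x i * x (i + 1) - x i * x (i - 1) - x (i - 1) ^ 2)
    + c * ((x (i + 1) - x i) / (1 / (N : ℝ)))
    - c * ((x i - x (i - 1)) / (1 / (N : ℝ)))) / (1 / (N : ℝ))

lemma schemeField_energy (N : ℕ) [NeZero N] (c : ℝ) (hc : 0 ≤ c) (x : ZMod N → ℝ) :
    ∑ i, x i * schemeField N c x i ≤ 0 := by
  let P : ZMod N → ℝ := fun i =>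
    N * (-(1 / 6) * (x i * x (i + 1) ^ 2 + x i ^ 2 * x (i + 1))
      + c * N * (x (i + 1) * (x (i + 1) - x i)))
  have key : ∀ i, x i * schemeField N c x i
      = (P i - P (i - 1)) - c * N ^ 2 * (x (i + 1) - x i) ^ 2 := by
    intro i
    simp only [schemeField, P, sub_add_cancel, one_div, div_inv_eq_mul]
    ring
  have hshift : ∑ i, P (i - 1) = ∑ i, P i := (Equiv.subRight (1 : ZMod N)).sum_comp P
  rw [Finset.sum_congr rfl fun i _ => key i, Finset.sum_sub_distrib, Finset.sum_sub_distrib,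
    hshift, sub_self, zero_sub, neg_nonpos]
  exact Finset.sum_nonneg fun i _ => by positivity

lemma schemeField_contDiff (N : ℕ) [NeZero N] (c : ℝ) : ContDiff ℝ 1 (schemeField N c) := by
  rw [contDiff_pi]
  intro i
  unfold schemeField
  have h : ∀ j, ContDiff ℝ 1 (fun x : ZMod N → ℝ => x j) := fun j => contDiff_apply ℝ ℝ j
  have h1 := h i
  have h2 := h (i + 1)
  have h3 := h (i - 1)
  simp only [div_eq_mul_inv]
  fun_prop

lemma energy_bound {ι : Type*} [Fintype ι] (G : (ι → ℝ) → ι → ℝ)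
    (hG : ∀ x, ∑ i, x i * G x i ≤ 0) (u : ℝ → ι → ℝ)
    (hu : ∀ t ∈ Ici (0 : ℝ), HasDerivWithinAt u (G (u t)) (Ici 0) t) :
    ∀ t ∈ Ici (0 : ℝ), ‖u t‖ ≤ √(∑ i, u 0 i ^ 2) := by
  intro t ht
  have hd : ∀ t ∈ Ici (0 : ℝ), HasDerivWithinAt (fun s => ∑ i, u s i ^ 2)
      (∑ i, 2 * (u t i * G (u t) i)) (Ici 0) t := by
    intro t ht
    apply HasDerivWithinAt.fun_sum
    intro i _
    have := ((hasDerivWithinAt_pi.1 (hu t ht)) i).fun_pow 2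
    refine this.congr_deriv ?_
    norm_num
    ring
  have hanti : AntitoneOn (fun s => ∑ i, u s i ^ 2) (Ici 0) := by
    refine antitoneOn_of_hasDerivWithinAt_nonpos (convex_Ici 0)
      (fun s hs => (hd s hs).continuousWithinAt)
      (fun s hs => (hd s (interior_subset hs)).mono interior_subset) (fun s _ => ?_)
    rw [← Finset.mul_sum]
    linarith [hG (u s)]
  have hle : ∑ i, u t i ^ 2 ≤ ∑ i, u 0 i ^ 2 := hanti (mem_Ici.2 le_rfl) ht ht
  refine (pi_norm_le_iff_of_nonneg (Real.sqrt_nonneg _)).2 fun i => ?_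
  apply Real.le_sqrt_of_sq_le
  rw [Real.norm_eq_abs, sq_abs]
  exact (Finset.single_le_sum (f := fun i => u t i ^ 2) (fun i _ => sq_nonneg _)
    (Finset.mem_univ i)).trans hle

lemma dissipative_ode {ι : Type*} [Fintype ι] (F : (ι → ℝ) → ι → ℝ)
    (hF : ContDiff ℝ 1 F) (hE : ∀ x, ∑ i, x i * F x i ≤ 0) (u0 : ι → ℝ) :
    ∃ u : ℝ → ι → ℝ, (u 0 = u0 ∧
      ∀ t ∈ Ici (0 : ℝ), HasDerivWithinAt u (F (u t)) (Ici 0) t) ∧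
      ∀ v : ℝ → ι → ℝ, v 0 = u0 →
        (∀ t ∈ Ici (0 : ℝ), HasDerivWithinAt v (F (v t)) (Ici 0) t) →
        ∀ t ∈ Ici (0 : ℝ), v t = u t := by
  have hs := Real.sqrt_nonneg (∑ i, u0 i ^ 2)
  let b : ContDiffBump (0 : ι → ℝ) :=
    ⟨√(∑ i, u0 i ^ 2) + 1, √(∑ i, u0 i ^ 2) + 2, by linarith, by linarith⟩
  let G : (ι → ℝ) → ι → ℝ := fun x => b x • F x
  have hGF : ∀ x, ‖x‖ ≤ √(∑ i, u0 i ^ 2) → G x = F x := by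
    intro x hx
    have : b x = 1 := b.one_of_mem_closedBall (by
      rw [mem_closedBall_zero_iff]
      change _ ≤ √(∑ i, u0 i ^ 2) + 1
      linarith)
    simp [G, this]
  have hGE : ∀ x, ∑ i, x i * G x i ≤ 0 := by
    intro x
    have : ∑ i, x i * G x i = b x * ∑ i, x i * F x i := by
      rw [Finset.mul_sum]
      refine Finset.sum_congr rfl fun i _ => ?_
      simp only [G, Pi.smul_apply, smul_eq_mul]
      ring
    rw [this]
    exact mul_nonpos_of_nonneg_of_nonpos b.nonneg (hE x)
  have hGc : ContDiff ℝ 1 G := b.contDiff.smul hF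
  have hGs : HasCompactSupport G := b.hasCompactSupport.smul_right
  obtain ⟨K, hK⟩ := hGc.lipschitzWith_of_hasCompactSupport hGs one_ne_zero
  obtain ⟨L, hL⟩ := hGs.exists_bound_of_continuous hGc.continuous
  obtain ⟨u, hu0, hu⟩ := global_ode G K L.toNNReal hK
    (fun x => (hL x).trans (Real.le_coe_toNNReal L)) u0
  have hub := energy_bound G hGE u hu
  rw [hu0] at hub
  refine ⟨u, ⟨hu0, fun t ht => ?_⟩, fun v hv0 hv t ht => ?_⟩
  · rw [← hGF _ (hub t ht)]
    exact hu t ht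
  have hvb := energy_bound F hE v hv
  rw [hv0] at hvb
  have hvG : ∀ t ∈ Ici (0 : ℝ), HasDerivWithinAt v (G (v t)) (Ici 0) t := by
    intro t ht
    rw [hGF _ (hvb t ht)]
    exact hv t ht
  exact ODE_solution_unique (v := fun _ => G) (a := 0) (b := t) (fun _ => hK)
    (fun s hs => (hvG s hs.1).continuousWithinAt.mono Icc_subset_Ici_self)
    (fun s hs => (hvG s hs.1).mono (Ici_subset_Ici.2 hs.1))
    (fun s hs => (hu s hs.1).continuousWithinAt.mono Icc_subset_Ici_self)
    (fun s hs => (hu s hs.1).mono (Ici_subset_Ici.2 hs.1))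
    (hv0.trans hu0.symm) ⟨ht, le_rfl⟩

/-- **Global existence and uniqueness for the semidiscrete scheme with linear
artificial viscosity:** for every `N ≥ 3`, every `ν ≥ 0` and every initial
nodal datum `u⁰`, there is a unique differentiable `u : [0,∞) → (ZMod N → ℝ)`
with `u(0) = u⁰` solving the mass-lumped Galerkin scheme with linear artificial
viscosity for all `t ≥ 0`. -/
theorem semidiscrete_existence_uniqueness
    (N : ℕ) [NeZero N] (hN : 3 ≤ N) (ν : ℝ) (hν : 0 ≤ ν)
    (u0 : ZMod N → ℝ) :
    ∃ u : ℝ → ZMod N → ℝ,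
      SolvesLinearViscosityScheme N ν u0 u ∧
        ∀ v : ℝ → ZMod N → ℝ, SolvesLinearViscosityScheme N ν u0 v →
          ∀ t ∈ Ici (0 : ℝ), v t = u t := by
  set c : ℝ := max ((Finset.univ.sup' ⟨(0 : ZMod N), Finset.mem_univ _⟩
                fun j => |u0 j|) * (1 / (N : ℝ)) / 2) ν with hc
  have hc0 : 0 ≤ c := hν.trans (le_max_right _ _)
  have hiff : ∀ u : ℝ → ZMod N → ℝ, SolvesLinearViscosityScheme N ν u0 u ↔
      (u 0 = u0 ∧ ∀ t ∈ Ici (0 : ℝ),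
        HasDerivWithinAt u (schemeField N c (u t)) (Ici 0) t) := by
    intro u
    unfold SolvesLinearViscosityScheme
    rw [← hc]
    constructor
    · rintro ⟨h0, h⟩
      exact ⟨funext h0, fun t ht => hasDerivWithinAt_pi.2 fun i => h i t ht⟩
    · rintro ⟨h0, h⟩
      exact ⟨fun i => congrFun h0 i, fun i t ht => hasDerivWithinAt_pi.1 (h t ht) i⟩
  obtain ⟨u, hu, huniq⟩ := dissipative_ode (schemeField N c) (schemeField_contDiff N c)
    (schemeField_energy N c hc0) u0
  exact ⟨u, (hiff u).2 hu, fun v hv => huniq v ((hiff v).1 hv).1 ((hiff v).1 hv).2⟩
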